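/- arXiv:2112.01443 — 2 statements merged into one kernel-verified Lean document; each statement's English description precedes it below -/
import Mathlib

section
/- For every positive integer g, there exists a simple 3-regular bipartite graph G with girth at least g such that the strong chromatic index of G satisfies χ'_s(G) ≥ 6. In particular, there exist bipartite graphs with maximum degree 3 and arbitrarily large girth that admit no strong edge-coloring with 5 colors. -/
open SimpleGraph Finset

/-- Two edges `e`, `f` of `G` are strongly adjacent if they are distinct and either share an
endpoint, or each shares an endpoint with a common third edge of `G`. -/
def SimpleGraph.StrongAdj {V : Type*} (G : SimpleGraph V) (e f : Sym2 V) : Prop :=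
  e ≠ f ∧ ((∃ v, v ∈ e ∧ v ∈ f) ∨
    ∃ h ∈ G.edgeSet, (∃ v, v ∈ e ∧ v ∈ h) ∧ (∃ v, v ∈ h ∧ v ∈ f))

/-- `φ` is a strong edge-coloring of `G`: strongly adjacent edges get distinct colors. -/
def SimpleGraph.IsStrongEdgeColoring {V : Type*} (G : SimpleGraph V) (φ : Sym2 V → ℕ) : Prop :=
  ∀ e ∈ G.edgeSet, ∀ f ∈ G.edgeSet, G.StrongAdj e f → φ e ≠ φ f

/-- The strong chromatic index of `G`: the least `n` admitting a strong edge-coloring of `G`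
using colors `0, …, n-1`. -/
noncomputable def SimpleGraph.strongChromaticIndex {V : Type*} (G : SimpleGraph V) : ℕ :=
  sInf {n | ∃ φ : Sym2 V → ℕ, G.IsStrongEdgeColoring φ ∧ ∀ e ∈ G.edgeSet, φ e < n}

/-- `G` is `k`-regular: every vertex has exactly `k` neighbors. -/
def SimpleGraph.IsKRegular {V : Type*} (G : SimpleGraph V) (k : ℕ) : Prop :=
  ∀ v : V, (G.neighborSet v).ncard = k

/-- `N(e)`: the set of edges of `G` sharing at least one endpoint with `e`. -/
def SimpleGraph.edgeNbhd {V : Type*} (G : SimpleGraph V) (e : Sym2 V) : Set (Sym2 V) :=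
  {f ∈ G.edgeSet | ∃ v, v ∈ e ∧ v ∈ f}

namespace SimpleGraph

variable {V : Type*}

/-! ### Non-backtracking walks and girth -/

lemma Walk.IsPath.notMem_edges_of_isChain {G : SimpleGraph V} {u v w : V} {p : G.Walk v w}
    (hp : p.IsPath) (hc : (s(u, v) :: p.edges).IsChain (· ≠ ·)) : s(u, v) ∉ p.edges := by
  cases p with
  | nil => simp
  | cons h q =>
    rw [Walk.cons_isPath_iff] at hp
    rw [Walk.edges_cons, List.isChain_cons_cons] at hc
    rw [Walk.edges_cons, List.mem_cons, not_or]
    exact ⟨hc.1, fun hq => hp.2 (q.snd_mem_support_of_mem_edges hq)⟩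

/-- A non-backtracking walk shorter than the girth is a path. -/
lemma Walk.isPath_of_isChain_edges {G : SimpleGraph V} {u v : V} (p : G.Walk u v)
    (hc : p.edges.IsChain (· ≠ ·)) (hlen : (p.length : ℕ∞) < G.egirth) : p.IsPath := by
  classical
  induction p with
  | nil => exact Walk.IsPath.nil
  | @cons u v w h q ih =>
    rw [Walk.edges_cons] at hc
    have hq : q.IsPath := ih hc.tail
      (lt_of_le_of_lt (by rw [Walk.length_cons]; exact_mod_cast Nat.le_succ _) hlen)
    refine (Walk.cons_isPath_iff h q).2 ⟨hq, fun hu => ?_⟩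
    have hcyc : (Walk.cons h (q.takeUntil u hu)).IsCycle :=
      (Walk.cons_isCycle_iff _ h).2 ⟨hq.takeUntil hu, fun hmem =>
        hq.notMem_edges_of_isChain hc (q.edges_takeUntil_subset_edges hu hmem)⟩
    refine absurd (egirth_le_length hcyc) (not_le.2 (lt_of_le_of_lt ?_ hlen))
    have := q.length_takeUntil_le_length hu
    simp only [Walk.length_cons]
    exact_mod_cast Nat.succ_le_succ this

/-- A nonempty closed non-backtracking walk that traverses every edge an even number of times is
longer than the girth. -/
lemma Walk.egirth_lt_length_of_even_count [DecidableEq V] {G : SimpleGraph V} {u : V}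
    (p : G.Walk u u) (hp : ¬ p.Nil) (hc : p.edges.IsChain (· ≠ ·))
    (heven : ∀ e, Even (p.edges.count e)) : G.egirth < p.length := by
  by_contra! hle
  cases p with
  | nil => exact hp Walk.Nil.nil
  | @cons _ v _ h q =>
    rw [Walk.edges_cons] at hc heven
    have hq : q.IsPath := q.isPath_of_isChain_edges hc.tail
      (lt_of_lt_of_le (by rw [Walk.length_cons]; exact_mod_cast Nat.lt_succ_self _) hle)
    have hev := heven s(u, v)
    rw [List.count_cons_self, List.count_eq_zero.2 (hq.notMem_edges_of_isChain hc)] at hev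
    exact absurd hev (by decide)

/-! ### The mod 2 homology cover -/

open Classical in
/-- The covering graph of `G` in which traversing an edge `e` flips the `e`-coordinate of a
vector over `ZMod 2`. -/
noncomputable def homologyCover (G : SimpleGraph V) : SimpleGraph (V × (Sym2 V → ZMod 2)) where
  Adj a b := G.Adj a.1 b.1 ∧ b.2 = a.2 + Pi.single s(a.1, b.1) 1
  symm := ⟨by
    rintro ⟨a, x⟩ ⟨b, y⟩ ⟨hab, hy⟩
    refine ⟨hab.symm, ?_⟩
    change y = x + Pi.single s(a, b) 1 at hy
    subst hy
    simp only [Sym2.eq_swap (a := b) (b := a), add_assoc, CharTwo.add_self_eq_zero, add_zero,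
      ← Pi.single_add, Pi.single_zero]⟩
  loopless := ⟨fun a h => G.loopless.irrefl a.1 h.1⟩

/-- The covering map from the homology cover. -/
noncomputable def homologyCover.proj (G : SimpleGraph V) : G.homologyCover →g G where
  toFun := Prod.fst
  map_rel' h := h.1

lemma IsKRegular.homologyCover {G : SimpleGraph V} {k : ℕ} (hG : G.IsKRegular k) :
    G.homologyCover.IsKRegular k := by
  classical
  rintro ⟨v, x⟩
  rw [← hG v]
  have himage : G.homologyCover.neighborSet (v, x) =
      (fun w => (w, x + Pi.single s(v, w) 1)) '' G.neighborSet v := by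
    ext ⟨w, y⟩
    simp only [mem_neighborSet, Set.mem_image, Prod.mk.injEq]
    constructor
    · rintro ⟨h, hy⟩
      exact ⟨w, h, rfl, hy.symm⟩
    · rintro ⟨_, h, rfl, hy⟩
      exact ⟨h, hy.symm⟩
  rw [himage]
  exact Set.ncard_image_of_injective _ fun _ _ h => (Prod.mk.inj h).1

lemma homologyCover.count_edges_map_proj [DecidableEq V] {G : SimpleGraph V}
    {a b : V × (Sym2 V → ZMod 2)} (p : G.homologyCover.Walk a b) (e : Sym2 V) :
    b.2 e = a.2 e + ((p.map (proj G)).edges.count e : ZMod 2) := by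
  induction p with
  | nil => simp
  | @cons a b c h q ih =>
    rw [ih, h.2, Walk.map_cons, Walk.edges_cons, List.count_cons]
    change _ = _ + ((_ + if s(a.1, b.1) == e then 1 else 0 : ℕ) : ZMod 2)
    by_cases he : e = s(a.1, b.1)
    · subst he
      simp [add_assoc, add_comm, add_left_comm]
    · simp [he, Ne.symm he]

lemma homologyCover.isChain_edges_map_proj {G : SimpleGraph V}
    {a b : V × (Sym2 V → ZMod 2)} (p : G.homologyCover.Walk a b)
    (hp : p.edges.IsChain (· ≠ ·)) : (p.map (proj G)).edges.IsChain (· ≠ ·) := by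
  induction p with
  | nil => simp
  | @cons a b c h q ih =>
    cases q with
    | nil => simp
    | @cons _ d _ h' q =>
      simp only [Walk.map_cons, Walk.edges_cons, List.isChain_cons_cons] at hp ih ⊢
      refine ⟨fun heq => hp.1 ?_, ih hp.2⟩
      change s(a.1, b.1) = s(b.1, d.1) at heq
      have had : a.1 = d.1 := by
        rw [Sym2.eq_swap] at heq
        exact Sym2.congr_right.1 heq
      have : a = d := by
        classical
        refine Prod.ext had ?_
        rw [h'.2, h.2, ← heq, add_assoc, ← Pi.single_add, CharTwo.add_self_eq_zero,
          Pi.single_zero, add_zero]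
      rw [this, Sym2.eq_swap]

lemma add_one_le_egirth_homologyCover {G : SimpleGraph V} {g : ℕ} (hg : (g : ℕ∞) ≤ G.egirth) :
    ((g + 1 : ℕ) : ℕ∞) ≤ G.homologyCover.egirth := by
  classical
  rw [le_egirth]
  intro a p hp
  have hlt : G.egirth < (p.map (homologyCover.proj G)).length := by
    refine Walk.egirth_lt_length_of_even_count _ ?_
      (homologyCover.isChain_edges_map_proj p hp.edges_nodup.isChain) fun e => ?_
    · rw [Walk.nil_map_iff]
      exact hp.not_nil
    · have := homologyCover.count_edges_map_proj p e
      rw [left_eq_add] at this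
      exact (ZMod.natCast_eq_zero_iff_even).1 this
  rw [Walk.length_map] at hlt
  have := lt_of_le_of_lt hg hlt
  exact_mod_cast this

/-- There are cubic bipartite graphs of arbitrarily large girth whose order is not a multiple
of `5`. -/
lemma exists_cubic_bipartite_egirth_ge (g : ℕ) :
    ∃ (V : Type) (_ : Fintype V) (G : SimpleGraph V),
      G.IsKRegular 3 ∧ G.Colorable 2 ∧ (g : ℕ∞) ≤ G.egirth ∧ ¬ 5 ∣ Fintype.card V := by
  classical
  induction g with
  | zero =>
    refine ⟨Fin 3 ⊕ Fin 3, inferInstance, completeBipartiteGraph (Fin 3) (Fin 3), ?_, ?_, by simp,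
      by simp⟩
    · intro v
      cases v with
      | inl i =>
        have : (completeBipartiteGraph (Fin 3) (Fin 3)).neighborSet (Sum.inl i) =
            Sum.inr '' Set.univ := by
          ext (j | j) <;> simp
        rw [this, Set.ncard_image_of_injective _ Sum.inr_injective, Set.ncard_univ,
          Nat.card_fin]
      | inr i =>
        have : (completeBipartiteGraph (Fin 3) (Fin 3)).neighborSet (Sum.inr i) =
            Sum.inl '' Set.univ := by
          ext (j | j) <;> simp
        rw [this, Set.ncard_image_of_injective _ Sum.inl_injective, Set.ncard_univ,
          Nat.card_fin]
    · exact (CompleteBipartiteGraph.bicoloring (Fin 3) (Fin 3)).colorable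
  | succ g ih =>
    obtain ⟨V, _, G, hreg, hcol, hgirth, hcard⟩ := ih
    refine ⟨V × (Sym2 V → ZMod 2), inferInstance, G.homologyCover, hreg.homologyCover,
      hcol.of_hom (homologyCover.proj G), add_one_le_egirth_homologyCover hgirth, ?_⟩
    rw [Fintype.card_prod, Fintype.card_fun, ZMod.card, Nat.prime_five.dvd_mul, not_or]
    exact ⟨hcard, fun h => absurd (Nat.prime_five.dvd_of_dvd_pow h) (by decide)⟩

/-! ### Strong edge-colorings of cubic graphs with five colors -/

lemma ncard_edgeNbhd [Fintype V] {G : SimpleGraph V} (hG : G.IsKRegular 3) {e : Sym2 V}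
    (he : e ∈ G.edgeSet) : (G.edgeNbhd e).ncard = 5 := by
  classical
  have hinc (v : V) : (G.incidenceSet v).ncard = 3 := by
    rw [← hG v, Set.ncard_eq_toFinset_card', Set.ncard_eq_toFinset_card', Set.toFinset_card,
      Set.toFinset_card]
    exact Fintype.card_congr (G.incidenceSetEquivNeighborSet v)
  induction e with
  | h u v =>
    have hadj : G.Adj u v := he
    have hunion : G.edgeNbhd s(u, v) = G.incidenceSet u ∪ G.incidenceSet v := by
      ext f
      simp [edgeNbhd, incidenceSet, and_or_left]
    have := Set.ncard_union_add_ncard_inter (G.incidenceSet u) (G.incidenceSet v)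
    rw [G.incidenceSet_inter_incidenceSet_of_adj hadj, Set.ncard_singleton, hinc, hinc] at this
    rw [hunion]
    lia

lemma IsStrongEdgeColoring.injOn_edgeNbhd {G : SimpleGraph V} {φ : Sym2 V → ℕ}
    (hφ : G.IsStrongEdgeColoring φ) {e : Sym2 V} (he : e ∈ G.edgeSet) :
    Set.InjOn φ (G.edgeNbhd e) := by
  rintro f ⟨hf, u, hue, huf⟩ h ⟨hh, v, hve, hvh⟩ heq
  by_contra hne
  exact hφ f hf h hh ⟨hne, Or.inr ⟨e, he, ⟨u, huf, hue⟩, ⟨v, hve, hvh⟩⟩⟩ heq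

/-- In a cubic graph with a strong 5-edge-coloring, the closed neighborhood of each edge contains
every color exactly once. -/
lemma IsStrongEdgeColoring.ncard_edgeNbhd_color [Fintype V] {G : SimpleGraph V} {φ : Sym2 V → ℕ}
    (hG : G.IsKRegular 3) (hφ : G.IsStrongEdgeColoring φ) (h5 : ∀ e ∈ G.edgeSet, φ e < 5)
    {e : Sym2 V} (he : e ∈ G.edgeSet) {c : ℕ} (hc : c < 5) :
    {f ∈ G.edgeNbhd e | φ f = c}.ncard = 1 := by
  have himage : φ '' G.edgeNbhd e = Set.Iio 5 := by
    refine Set.eq_of_subset_of_ncard_le ?_ ?_ (Set.finite_Iio 5)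
    · rintro _ ⟨f, hf, rfl⟩
      exact h5 f hf.1
    · rw [(hφ.injOn_edgeNbhd he).ncard_image, ncard_edgeNbhd hG he,
        Set.ncard_eq_toFinset_card']
      simp
  obtain ⟨f, hf, hfc⟩ : c ∈ φ '' G.edgeNbhd e := himage ▸ hc
  rw [Set.ncard_eq_one]
  refine ⟨f, Set.eq_singleton_iff_unique_mem.2 ⟨⟨hf, hfc⟩, fun h hh => ?_⟩⟩
  exact hφ.injOn_edgeNbhd he hh.1 hf (hh.2.trans hfc.symm)

/-- The order of a cubic graph with a strong 5-edge-coloring is a multiple of `5`. -/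
lemma IsStrongEdgeColoring.five_dvd_card [Fintype V] {G : SimpleGraph V} {φ : Sym2 V → ℕ}
    (hG : G.IsKRegular 3) (hφ : G.IsStrongEdgeColoring φ) (h5 : ∀ e ∈ G.edgeSet, φ e < 5) :
    5 ∣ Fintype.card V := by
  classical
  have hdeg (v : V) : G.degree v = 3 := by
    rw [← hG v, Set.ncard_eq_toFinset_card', ← G.card_neighborFinset_eq_degree]
    rfl
  have hsum := G.sum_degrees_eq_twice_card_edges
  simp only [hdeg, Finset.sum_const, Finset.card_univ, smul_eq_mul] at hsum
  have hcount := Finset.sum_card_bipartiteAbove_eq_sum_card_bipartiteBelow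
    (s := G.edgeFinset) (t := {f ∈ G.edgeFinset | φ f = 0}) (fun e f => ∃ v, v ∈ e ∧ v ∈ f)
  have habove : ∀ e ∈ G.edgeFinset, (Finset.bipartiteAbove (fun e f => ∃ v, v ∈ e ∧ v ∈ f)
      {f ∈ G.edgeFinset | φ f = 0} e).card = 1 := by
    intro e he
    rw [← hφ.ncard_edgeNbhd_color hG h5 (mem_edgeFinset.1 he) (c := 0) (by norm_num),
      ← Set.ncard_coe_finset]
    congr 1
    ext f
    simp [Finset.bipartiteAbove, edgeNbhd, and_right_comm]
  have hbelow : ∀ f ∈ ({f ∈ G.edgeFinset | φ f = 0} : Finset (Sym2 V)),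
      (Finset.bipartiteBelow (fun e f => ∃ v, v ∈ e ∧ v ∈ f) G.edgeFinset f).card = 5 := by
    intro f hf
    rw [← ncard_edgeNbhd hG (mem_edgeFinset.1 (Finset.mem_filter.1 hf).1),
      ← Set.ncard_coe_finset]
    congr 1
    ext e
    simp [Finset.bipartiteBelow, edgeNbhd, and_comm]
  rw [Finset.sum_congr rfl habove, Finset.sum_congr rfl hbelow] at hcount
  simp only [Finset.sum_const, smul_eq_mul] at hcount
  lia

lemma le_strongChromaticIndex_of_not_exists [Finite V] {G : SimpleGraph V} {n : ℕ}
    (h : ¬ ∃ φ : Sym2 V → ℕ, G.IsStrongEdgeColoring φ ∧ ∀ e ∈ G.edgeSet, φ e < n) :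
    n + 1 ≤ G.strongChromaticIndex := by
  refine le_csInf ?_ ?_
  · obtain ⟨m, ⟨f⟩⟩ := Finite.exists_equiv_fin (Sym2 V)
    exact ⟨m, fun e => f e, fun e _ e' _ hee' heq => hee'.1 (f.injective (Fin.ext heq)),
      fun e _ => (f e).isLt⟩
  · rintro m ⟨φ, hφ, hm⟩
    by_contra! hlt
    exact h ⟨φ, hφ, fun e he => (hm e he).trans_le (Nat.lt_succ_iff.1 hlt)⟩

end SimpleGraph

/-- For every positive integer `g`, there is a simple 3-regular bipartite graph `G` with
girth at least `g` and `χ'ₛ(G) ≥ 6`; in particular, `G` admits no strong edge-coloring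
with 5 colors. -/
theorem stmt1 (g : ℕ) (hg : 0 < g) :
    ∃ (V : Type) (_ : Fintype V) (G : SimpleGraph V),
      G.IsKRegular 3 ∧ G.Colorable 2 ∧ (g : ℕ∞) ≤ G.egirth ∧
        6 ≤ G.strongChromaticIndex ∧
        ¬ ∃ φ : Sym2 V → ℕ, G.IsStrongEdgeColoring φ ∧ ∀ e ∈ G.edgeSet, φ e < 5 := by
  obtain ⟨V, _, G, hreg, hcol, hgirth, hcard⟩ := exists_cubic_bipartite_egirth_ge g
  have hno : ¬ ∃ φ : Sym2 V → ℕ, G.IsStrongEdgeColoring φ ∧ ∀ e ∈ G.edgeSet, φ e < 5 :=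
    fun ⟨_, hφ, h5⟩ => hcard (hφ.five_dvd_card hreg h5)
  exact ⟨V, inferInstance, G, hreg, hcol, hgirth, le_strongChromaticIndex_of_not_exists hno, hno⟩
end

section
/- If G is a simple 3-regular graph on a finite vertex set and 5 does not divide |E(G)|, then the strong chromatic index of G satisfies χ'_s(G) ≥ 6. -/
open SimpleGraph Finset

open Classical in
/-- In a 3-regular graph, every edge meets exactly five edges, itself included. -/
lemma SimpleGraph.IsKRegular.card_edges_meeting {V : Type*} [Fintype V] {G : SimpleGraph V}
    (hreg : G.IsKRegular 3) {e : Sym2 V} (he : e ∈ G.edgeFinset) :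
    #{f ∈ G.edgeFinset | ∃ v, v ∈ e ∧ v ∈ f} = 5 := by
  have hdeg : ∀ v, #(G.incidenceFinset v) = 3 := fun v => by
    rw [card_incidenceFinset_eq_degree, ← card_neighborSet_eq_degree, ← hreg v,
      Set.ncard_eq_toFinset_card', Set.toFinset_card]
  induction e using Sym2.ind with | _ u v =>
  have huv : G.Adj u v := by simpa using he
  have hunion : {f ∈ G.edgeFinset | ∃ w, w ∈ s(u, v) ∧ w ∈ f} =
      G.incidenceFinset u ∪ G.incidenceFinset v := by
    ext f
    simp only [mem_filter, mem_edgeFinset, Sym2.mem_iff, mem_union, mem_incidenceFinset,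
      incidenceSet, Set.mem_ofPred_eq, or_and_right, exists_or, exists_eq_left]
    tauto
  have hinter : G.incidenceFinset u ∩ G.incidenceFinset v = {s(u, v)} := by
    rw [← Finset.coe_inj]
    simpa using G.incidenceSet_inter_incidenceSet_of_adj huv
  have hcard := card_union_add_card_inter (G.incidenceFinset u) (G.incidenceFinset v)
  rw [hinter, hdeg, hdeg, card_singleton] at hcard
  rw [hunion]
  omega

open Classical in
/-- In a strong edge-coloring of a 3-regular graph with five colors, every edge meets exactly one
edge of each color. -/
lemma SimpleGraph.IsStrongEdgeColoring.card_color_meeting {V : Type*} [Fintype V]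
    {G : SimpleGraph V} (hreg : G.IsKRegular 3) {φ : Sym2 V → ℕ} (hφ : G.IsStrongEdgeColoring φ)
    (hlt : ∀ e ∈ G.edgeSet, φ e < 5) {c : ℕ} (hc : c < 5) {e : Sym2 V} (he : e ∈ G.edgeFinset) :
    #{f ∈ G.edgeFinset | φ f = c ∧ ∃ v, v ∈ e ∧ v ∈ f} = 1 := by
  set N := {f ∈ G.edgeFinset | ∃ v, v ∈ e ∧ v ∈ f} with hN
  have hinj : Set.InjOn φ N := by
    intro f hf g hg hfg
    simp only [hN, coe_filter, mem_edgeFinset, Set.mem_ofPred_eq] at hf hg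
    by_contra hne
    obtain ⟨hf, v, hve, hvf⟩ := hf
    exact hφ f hf g hg.1 ⟨hne, .inr ⟨e, by simpa using he, ⟨v, hvf, hve⟩, hg.2⟩⟩ hfg
  have himage : N.image φ = range 5 := by
    refine eq_of_subset_of_card_le (fun c hc => ?_) ?_
    · obtain ⟨f, hf, rfl⟩ := mem_image.1 hc
      exact mem_range.2 (hlt f (by simpa using (mem_filter.1 hf).1))
    · rw [card_image_of_injOn hinj, hN, hreg.card_edges_meeting he, card_range]
  obtain ⟨f, hf, hfc⟩ := mem_image.1 (himage ▸ mem_range.2 hc)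
  refine card_eq_one.2 ⟨f, ?_⟩
  ext g
  rw [mem_singleton]
  constructor
  · intro hg
    obtain ⟨hgE, hgc, hge⟩ := mem_filter.1 hg
    exact hinj (mem_filter.2 ⟨hgE, hge⟩) hf (hgc.trans hfc.symm)
  · rintro rfl
    obtain ⟨hgE, hge⟩ := mem_filter.1 hf
    exact mem_filter.2 ⟨hgE, hfc, hge⟩

/-- A 3-regular graph with a strong edge-coloring in five colors has a multiple of five edges. -/
lemma SimpleGraph.IsStrongEdgeColoring.five_dvd_ncard_edgeSet {V : Type*} [Fintype V]
    {G : SimpleGraph V} (hreg : G.IsKRegular 3) {φ : Sym2 V → ℕ} (hφ : G.IsStrongEdgeColoring φ)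
    (hlt : ∀ e ∈ G.edgeSet, φ e < 5) : 5 ∣ G.edgeSet.ncard := by
  classical
  have hcount := sum_card_bipartiteAbove_eq_sum_card_bipartiteBelow
    (s := G.edgeFinset) (t := {f ∈ G.edgeFinset | φ f = 0}) (fun e f => ∃ v, v ∈ e ∧ v ∈ f)
  have habove : ∀ e ∈ G.edgeFinset, #(bipartiteAbove (fun e f => ∃ v, v ∈ e ∧ v ∈ f)
      {f ∈ G.edgeFinset | φ f = 0} e) = 1 := fun e he => by
    rw [← hφ.card_color_meeting hreg hlt (by norm_num : 0 < 5) he, bipartiteAbove, filter_filter]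
  have hbelow : ∀ f ∈ {f ∈ G.edgeFinset | φ f = 0}, #(bipartiteBelow
      (fun e f => ∃ v, v ∈ e ∧ v ∈ f) G.edgeFinset f) = 5 := fun f hf => by
    rw [← hreg.card_edges_meeting (mem_filter.1 hf).1]
    simp only [bipartiteBelow, and_comm]
  rw [sum_congr rfl habove, sum_congr rfl hbelow, sum_const, sum_const, smul_eq_mul, mul_one,
    smul_eq_mul] at hcount
  rw [Set.ncard_eq_toFinset_card', ← edgeFinset, hcount]
  exact dvd_mul_left _ _

/-- A finite graph has a strong edge-coloring with `G.strongChromaticIndex` colors. -/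
lemma SimpleGraph.exists_isStrongEdgeColoring_lt_strongChromaticIndex {V : Type*} [Fintype V]
    (G : SimpleGraph V) :
    ∃ φ : Sym2 V → ℕ, G.IsStrongEdgeColoring φ ∧ ∀ e ∈ G.edgeSet, φ e < G.strongChromaticIndex := by
  classical
  refine Nat.sInf_mem
    (s := {n | ∃ φ : Sym2 V → ℕ, G.IsStrongEdgeColoring φ ∧ ∀ e ∈ G.edgeSet, φ e < n})
    ⟨Fintype.card (Sym2 V), fun e => Fintype.equivFin _ e, ?_, fun e _ => Fin.is_lt _⟩
  intro e _ f _ hef h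
  exact hef.1 ((Fintype.equivFin _).injective (Fin.ext h))

/-- If `G` is a finite simple 3-regular graph and 5 does not divide `|E(G)|`, then
`χ'ₛ(G) ≥ 6`. -/
theorem stmt13 {V : Type*} [Fintype V] (G : SimpleGraph V) (hreg : G.IsKRegular 3)
    (hdvd : ¬ 5 ∣ G.edgeSet.ncard) :
    6 ≤ G.strongChromaticIndex := by
  by_contra! h
  obtain ⟨φ, hφ, hlt⟩ := G.exists_isStrongEdgeColoring_lt_strongChromaticIndex
  exact hdvd (hφ.five_dvd_ncard_edgeSet hreg fun e he => (hlt e he).trans_le (by omega))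
end
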